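/- Let 𝓞 be the ring of integers of a number field and let H be a finite-index subgroup of E of level m. Then H is a congruence subgroup of E if and only if E(m𝓞) ⊆ H. -/

import Mathlib

open NumberField Matrix

variable (K : Type*) [Field K] [NumberField K]

/-- The elementary matrix `T_x = [[1, x], [0, 1]]` in `SL(2, 𝓞)`. -/
def T (x : 𝓞 K) : Matrix.SpecialLinearGroup (Fin 2) (𝓞 K) :=
  ⟨!![1, x; 0, 1], by simp [Matrix.det_fin_two_of]⟩

/-- The matrix `S = [[0, 1], [-1, 0]]` in `SL(2, 𝓞)`. -/
def S : Matrix.SpecialLinearGroup (Fin 2) (𝓞 K) :=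
  ⟨!![0, 1; -1, 0], by simp [Matrix.det_fin_two_of]⟩

/-- `E` is the subgroup of `SL(2, 𝓞)` generated by `S` and all `T_x`, `x ∈ 𝓞`. -/
def E : Subgroup (Matrix.SpecialLinearGroup (Fin 2) (𝓞 K)) :=
  Subgroup.closure ({S K} ∪ Set.range (T K))

/-- The reduction homomorphism `SL(2, 𝓞) → SL(2, 𝓞/π)`. -/
def red (π : Ideal (𝓞 K)) :
    Matrix.SpecialLinearGroup (Fin 2) (𝓞 K) →*
      Matrix.SpecialLinearGroup (Fin 2) ((𝓞 K) ⧸ π) :=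
  Matrix.SpecialLinearGroup.map (Ideal.Quotient.mk π)

/-- The principal congruence subgroup `Γ(π)`, the kernel of reduction mod `π`. -/
def Gamma (π : Ideal (𝓞 K)) : Subgroup (Matrix.SpecialLinearGroup (Fin 2) (𝓞 K)) :=
  MonoidHom.ker (red K π)

/-- A subgroup of `E` is a congruence subgroup if it contains `E(π) = E ∩ Γ(π)`
(viewed inside `E` as `Γ(π).subgroupOf E`) for some nonzero ideal `π` of `𝓞`. -/
def IsCongruenceE (H : Subgroup (E K)) : Prop :=
  ∃ π : Ideal (𝓞 K), π ≠ ⊥ ∧ (Gamma K π).subgroupOf (E K) ≤ H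

/-- The normal closure in `E` of the set of the matrices `T_{mx}`, `x ∈ 𝓞`. -/
def TclosureE (m : ℕ) : Subgroup (E K) :=
  Subgroup.normalClosure
    {x : E K | ∃ a : 𝓞 K,
      (x : Matrix.SpecialLinearGroup (Fin 2) (𝓞 K)) = T K ((m : 𝓞 K) * a)}

/-- `H` has level `m` : `m` is the smallest positive integer such that the normal closure
in `E` of `{T_{mx} : x ∈ 𝓞}` is contained in `H`. -/
def HasLevelE (H : Subgroup (E K)) (m : ℕ) : Prop :=
  0 < m ∧ TclosureE K m ≤ H ∧ ∀ k : ℕ, 0 < k → TclosureE K k ≤ H → m ≤ k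

/-- A semilocal commutative ring has stable range one. -/
theorem IsCoprime.exists_isUnit_add_mul {R : Type*} [CommRing R] [Finite (MaximalSpectrum R)]
    {a b : R} (h : IsCoprime a b) : ∃ s : R, IsUnit (a + s * b) := by
  classical
  obtain ⟨s, hs⟩ := Ideal.exists_forall_sub_mem_ideal
    (I := fun P : MaximalSpectrum R => P.asIdeal)
    (fun P Q hPQ => Ideal.isCoprime_of_isMaximal (fun e => hPQ (MaximalSpectrum.ext e)))
    (fun P => if a ∈ P.asIdeal then 1 else 0)
  refine ⟨s, ?_⟩
  by_contra hu
  obtain ⟨P, hP, hmem⟩ := exists_max_ideal_of_mem_nonunits hu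
  have hsP := hs ⟨P, hP⟩
  by_cases ha : a ∈ P
  · simp only [ha, if_true] at hsP
    obtain ⟨x, y, hxy⟩ := h
    refine hP.ne_top ((Ideal.eq_top_iff_one P).2 ?_)
    have hb : b ∈ P := by
      have h1 := P.sub_mem (P.sub_mem hmem ha) (P.mul_mem_right b hsP)
      ring_nf at h1
      exact h1
    rw [← hxy]
    exact P.add_mem (P.mul_mem_left _ ha) (P.mul_mem_left _ hb)
  · simp only [ha, if_false, sub_zero] at hsP
    exact ha (by simpa using P.sub_mem hmem (P.mul_mem_right b hsP))

theorem coe_S : (S K : Matrix (Fin 2) (Fin 2) (𝓞 K)) = !![0, 1; -1, 0] := rfl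

theorem coe_T (x : 𝓞 K) : (T K x : Matrix (Fin 2) (Fin 2) (𝓞 K)) = !![1, x; 0, 1] := rfl

/-- The product of a lower elementary matrix, a conjugate of `T_q` whose upper left entry is
`1 + q`, and `T_y`. -/
theorem coe_conj_mul_conj_mul_T (x q y : 𝓞 K) :
    ((S K * T K (-x) * (S K)⁻¹ *
      (S K * T K 1 * (S K)⁻¹ * T K q * (S K * T K 1 * (S K)⁻¹)⁻¹) * T K y :
        Matrix.SpecialLinearGroup (Fin 2) (𝓞 K)) : Matrix (Fin 2) (Fin 2) (𝓞 K)) =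
      !![1 + q, (1 + q) * y + q;
        x * (1 + q) - q, (x * (1 + q) - q) * y + x * q + 1 - q] := by
  simp only [Matrix.SpecialLinearGroup.coe_mul,
    Matrix.SpecialLinearGroup.coe_inv, coe_S, coe_T, Matrix.adjugate_fin_two_of,
    Matrix.mul_fin_two]
  ext1 i j
  fin_cases i <;> fin_cases j <;> simp only [Fin.zero_eta, Fin.mk_one, Matrix.of_apply,
    Matrix.cons_val', Matrix.cons_val_zero, Matrix.cons_val_one, Matrix.cons_val_fin_one] <;> ring

theorem S_mem_E : S K ∈ E K := Subgroup.subset_closure (Or.inl rfl)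

theorem T_mem_E (x : 𝓞 K) : T K x ∈ E K := Subgroup.subset_closure (Or.inr ⟨x, rfl⟩)

theorem T_mem_TclosureE (m : ℕ) {x : 𝓞 K} (hx : (m : 𝓞 K) ∣ x) :
    (⟨T K x, T_mem_E K x⟩ : E K) ∈ TclosureE K m := by
  obtain ⟨a, rfl⟩ := hx
  exact Subgroup.subset_normalClosure ⟨a, rfl⟩

/-- Congruence of two matrices in `SL(2, 𝓞)` whose upper left entry is a unit modulo `π`
can be tested on the other three entries. -/
theorem mul_inv_mem_Gamma (π : Ideal (𝓞 K))
    (g h : Matrix.SpecialLinearGroup (Fin 2) (𝓞 K))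
    (hu : IsUnit (Ideal.Quotient.mk π (g 0 0)))
    (h00 : Ideal.Quotient.mk π (h 0 0) = Ideal.Quotient.mk π (g 0 0))
    (h01 : Ideal.Quotient.mk π (h 0 1) = Ideal.Quotient.mk π (g 0 1))
    (h10 : Ideal.Quotient.mk π (h 1 0) = Ideal.Quotient.mk π (g 1 0)) :
    g * h⁻¹ ∈ Gamma K π := by
  have hg := congrArg (Ideal.Quotient.mk π) ((Matrix.det_fin_two _).symm.trans g.det_coe)
  have hh := congrArg (Ideal.Quotient.mk π) ((Matrix.det_fin_two _).symm.trans h.det_coe)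
  simp only [map_sub, map_mul, map_one] at hg hh
  rw [h00, h01, h10] at hh
  have h11 : Ideal.Quotient.mk π (h 1 1) = Ideal.Quotient.mk π (g 1 1) :=
    hu.mul_left_cancel (by linear_combination hh - hg)
  rw [Gamma, MonoidHom.mem_ker, map_mul, map_inv, mul_inv_eq_one]
  ext i j
  fin_cases i <;> fin_cases j <;> simp [red, h00, h01, h10, h11]

/-- `E(m𝓞)` is contained in the product of `E(π)` and the normal closure in `E` of the
matrices `T_{mx}`. -/
theorem exists_mul_inv_mem_Gamma (m : ℕ) {π : Ideal (𝓞 K)} (hπ : π ≠ ⊥) (g : E K)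
    (hg : (g : Matrix.SpecialLinearGroup (Fin 2) (𝓞 K)) ∈ Gamma K (Ideal.span {(m : 𝓞 K)})) :
    ∃ h₁ ∈ TclosureE K m, ∃ h₂ ∈ TclosureE K m,
      ((h₁ * g * h₂⁻¹ : E K) : Matrix.SpecialLinearGroup (Fin 2) (𝓞 K)) ∈ Gamma K π := by
  have : (TclosureE K m).Normal := Subgroup.normalClosure_normal
  have : Finite (𝓞 K ⧸ π) := Ideal.finiteQuotientOfFreeOfNeBot π hπ
  set a := (g : Matrix.SpecialLinearGroup (Fin 2) (𝓞 K)) 0 0 with ha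
  set b := (g : Matrix.SpecialLinearGroup (Fin 2) (𝓞 K)) 0 1 with hb
  set c := (g : Matrix.SpecialLinearGroup (Fin 2) (𝓞 K)) 1 0 with hc
  set d := (g : Matrix.SpecialLinearGroup (Fin 2) (𝓞 K)) 1 1 with hd
  have hdet : a * d - b * c = 1 :=
    (Matrix.det_fin_two _).symm.trans (g : Matrix.SpecialLinearGroup (Fin 2) (𝓞 K)).det_coe
  have hentry (i j : Fin 2) : (m : 𝓞 K) ∣
      (g : Matrix.SpecialLinearGroup (Fin 2) (𝓞 K)) i j -
        (1 : Matrix (Fin 2) (Fin 2) (𝓞 K)) i j := by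
    have h := congrArg (fun M => M i j) (MonoidHom.mem_ker.1 hg)
    rw [← Ideal.mem_span_singleton, ← Ideal.Quotient.mk_eq_mk_iff_sub_mem]
    refine Eq.trans h ?_
    fin_cases i <;> fin_cases j <;> simp
  have hma : (m : 𝓞 K) ∣ a - 1 := by simpa using hentry 0 0
  have hmb : (m : 𝓞 K) ∣ b := by simpa using hentry 0 1
  have hmc : (m : 𝓞 K) ∣ c := by simpa using hentry 1 0
  have hcop : IsCoprime a (c * c) := by
    have : IsCoprime a c := ⟨d, -b, by linear_combination hdet⟩
    exact this.mul_right this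
  obtain ⟨s', hs'⟩ := (hcop.map (Ideal.Quotient.mk π)).exists_isUnit_add_mul
  obtain ⟨s, rfl⟩ := Ideal.Quotient.mk_surjective s'
  rw [← map_mul, ← map_add] at hs'
  obtain ⟨v', hv'⟩ := hs'.exists_right_inv
  obtain ⟨v, rfl⟩ := Ideal.Quotient.mk_surjective v'
  set u := a + s * (c * c) with hu
  set b' := b + s * c * d with hb'
  have hmu : (m : 𝓞 K) ∣ u - 1 := by
    have : u - 1 = (a - 1) + s * c * c := by rw [hu]; ring
    exact this ▸ dvd_add hma (hmc.mul_left _)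
  have hmb' : (m : 𝓞 K) ∣ b' := dvd_add hmb ((hmc.mul_left s).mul_right d)
  set x := (c + (u - 1)) * v with hx
  set y := (b' - (u - 1)) * v with hy
  have hmx : (m : 𝓞 K) ∣ -x := ((dvd_add hmc hmu).mul_right v).neg_right
  have hmy : (m : 𝓞 K) ∣ y := (dvd_sub hmb' hmu).mul_right v
  let σ : E K := ⟨S K, S_mem_E K⟩
  let τ (z : 𝓞 K) : E K := ⟨T K z, T_mem_E K z⟩
  let l : E K := σ * τ 1 * σ⁻¹
  refine ⟨τ (s * c), T_mem_TclosureE K m (hmc.mul_left s),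
    σ * τ (-x) * σ⁻¹ * (l * τ (u - 1) * l⁻¹) * τ y, ?_, ?_⟩
  · refine mul_mem (mul_mem ?_ ?_) (T_mem_TclosureE K m hmy)
    · exact Subgroup.Normal.conj_mem inferInstance _ (T_mem_TclosureE K m hmx) _
    · exact Subgroup.Normal.conj_mem inferInstance _ (T_mem_TclosureE K m hmu) _
  · have hgM : ((τ (s * c) * g : E K) : Matrix.SpecialLinearGroup (Fin 2) (𝓞 K)) =
        (!![u, b'; c, d] : Matrix (Fin 2) (Fin 2) (𝓞 K)) := by
      rw [Subgroup.coe_mul, Matrix.SpecialLinearGroup.coe_mul, coe_T,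
        Matrix.eta_fin_two (g : Matrix.SpecialLinearGroup (Fin 2) (𝓞 K)).1,
        ← ha, ← hb, ← hc, ← hd, Matrix.mul_fin_two, hu, hb']
      ring_nf
    have hhM := coe_conj_mul_conj_mul_T K x (u - 1) y
    have hv : Ideal.Quotient.mk π u * Ideal.Quotient.mk π v = 1 := hv'
    rw [Subgroup.coe_mul, Subgroup.coe_inv]
    refine mul_inv_mem_Gamma K π _
      (S K * T K (-x) * (S K)⁻¹ *
        (S K * T K 1 * (S K)⁻¹ * T K (u - 1) * (S K * T K 1 * (S K)⁻¹)⁻¹) * T K y) ?_ ?_ ?_ ?_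
    · rw [hgM]
      exact hs'
    · rw [hgM, hhM]
      simp
    · rw [hgM, hhM]
      simp [hy]
      linear_combination (Ideal.Quotient.mk π b' - (Ideal.Quotient.mk π u - 1)) * hv
    · rw [hgM, hhM]
      simp [hx]
      linear_combination (Ideal.Quotient.mk π c + (Ideal.Quotient.mk π u - 1)) * hv

/-- **Theorem 3.2 (Wohlfahrt's theorem for `E`).** Let `H` be a finite-index subgroup of `E`
of level `m`.  Then `H` is a congruence subgroup of `E` iff `E(m𝓞) ⊆ H`. -/
theorem wohlfahrt_E (H : Subgroup (E K)) (hfin : H.FiniteIndex) (m : ℕ)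
    (hlevel : HasLevelE K H m) :
    IsCongruenceE K H ↔ (Gamma K (Ideal.span {(m : 𝓞 K)})).subgroupOf (E K) ≤ H := by
  refine ⟨?_, fun h => ⟨_, ?_, h⟩⟩
  · rintro ⟨π, hπ, hH⟩ g hg
    obtain ⟨h₁, hh₁, h₂, hh₂, hΓ⟩ := exists_mul_inv_mem_Gamma K m hπ g (Subgroup.mem_subgroupOf.1 hg)
    have hmem : h₁ * g * h₂⁻¹ ∈ H := hH (Subgroup.mem_subgroupOf.2 hΓ)
    rwa [H.mul_mem_cancel_right (H.inv_mem (hlevel.2.1 hh₂)),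
      H.mul_mem_cancel_left (hlevel.2.1 hh₁)] at hmem
  · rw [Ne, Ideal.span_singleton_eq_bot]
    exact Nat.cast_ne_zero.2 hlevel.1.ne'
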